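/- arXiv:2605.09569 — 2 statements merged into one kernel-verified Lean document; each statement's English description precedes it below -/
import Mathlib

section
/- (Analysis of the Bonferroni-corrected truncated χ² test.) Let α ∈ (0,1) and let c > 0 be a constant. Set C₀ = max( 1/log(1+c), 2 ). There exist constants C_μ, C_h > 0 depending only on α and c such that for all positive integers d₁, d₂, all integers 1 ≤ s₁ ≤ d₁, 1 ≤ s₂ ≤ d₂ with (d₂/s₂²)·log C(d₁,s₁) ≥ c, and every μ > 0 with μ² ≥ C_μ·( (1/s₁)·log(1 + (d₂/s₂²)·log C(d₁,s₁)) + (1/(s₁s₂))·log C(d₁,s₁) ), the test Δ(Y) = 1{ max_{J₁ ⊆ {1,…,d₁}, |J₁| = s₁} Σ_{j=1}^{d₂} ((Ȳ_{J₁,j})² − ν_{τ*})·1(|Ȳ_{J₁,j}| > τ*) > C_h·( s₂·log(1 + (d₂/s₂²)·log C(d₁,s₁)) + log C(d₁,s₁) ) }, where Ȳ_{J₁,j} = s₁^{−1/2}·Σ_{i∈J₁} Y_{ij} and τ* = √(C₀·log(1 + (d₂/s₂²)·log C(d₁,s₁))), satisfies R(Δ,μ) ≤ α. -/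
open MeasureTheory ProbabilityTheory

noncomputable def Pmeas (d₁ d₂ : ℕ) (X : Fin d₁ → Fin d₂ → ℝ) :
    Measure (Fin d₁ → Fin d₂ → ℝ) :=
  Measure.pi fun i => Measure.pi fun j => gaussianReal (X i j) 1

def Theta (d₁ d₂ s₁ s₂ : ℕ) (μ : ℝ) : Set (Fin d₁ → Fin d₂ → ℝ) :=
  {X | ∃ (S₁ : Finset (Fin d₁)) (S₂ : Finset (Fin d₂)),
    S₁.card = s₁ ∧ S₂.card = s₂ ∧
    (∀ i j, i ∈ S₁ → j ∈ S₂ → μ ≤ X i j) ∧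
    (∀ i j, ¬(i ∈ S₁ ∧ j ∈ S₂) → X i j = 0)}

noncomputable def risk (d₁ d₂ s₁ s₂ : ℕ) (μ : ℝ)
    (Δ : (Fin d₁ → Fin d₂ → ℝ) → Bool) : ℝ :=
  (Pmeas d₁ d₂ 0 {y | Δ y = true}).toReal +
    ⨆ X ∈ Theta d₁ d₂ s₁ s₂ μ, (Pmeas d₁ d₂ X {y | Δ y = false}).toReal

noncomputable def muStar (η : ℝ) (d₁ d₂ s₁ s₂ : ℕ) : ℝ :=
  sInf {μ : ℝ | 0 < μ ∧ ∃ Δ : (Fin d₁ → Fin d₂ → ℝ) → Bool,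
    Measurable Δ ∧ risk d₁ d₂ s₁ s₂ μ Δ < η}


/-- ν_τ = E[Z² | |Z| > τ] for Z ~ N(0,1). -/
noncomputable def nuTau (τ : ℝ) : ℝ :=
  (∫ z in {z : ℝ | τ < |z|}, z ^ 2 ∂(gaussianReal 0 1)) /
    ((gaussianReal 0 1) {z : ℝ | τ < |z|}).toReal

lemma pi_pi_map_flip {ι κ : Type*} [Fintype ι] [Fintype κ] (P : ι → κ → Measure ℝ)
    [∀ i j, IsProbabilityMeasure (P i j)] :
    (Measure.pi fun i => Measure.pi fun j => P i j).map (fun y j i => y i j) =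
      Measure.pi fun j => Measure.pi fun i => P i j := by
  symm
  refine Measure.pi_eq_generateFrom
    (C := fun _ => Set.pi Set.univ '' Set.pi Set.univ fun _ => {s : Set ℝ | MeasurableSet s})
    (fun _ => generateFrom_pi) (fun _ => isPiSystem_pi)
    (fun j => ⟨fun _ => Set.univ, fun _ => ⟨fun _ => Set.univ, by simp, by simp⟩,
      fun _ => measure_lt_top _ _, by simp [Set.iUnion_const]⟩) fun s hs => ?_
  choose t ht hts using hs
  have hms : ∀ j i, MeasurableSet (t j i) := fun j i => by simpa using ht j i
  rw [Measure.map_apply (by fun_prop)]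
  · have : (fun (y : ι → κ → ℝ) j i => y i j) ⁻¹' (Set.univ.pi s) =
        Set.univ.pi fun i => Set.univ.pi fun j => t j i := by
      ext y
      simp only [← hts, Set.mem_preimage, Set.mem_pi, Set.mem_univ, true_imp_iff]
      exact forall_comm
    rw [this]
    simp only [← hts, Measure.pi_pi]
    exact Finset.prod_comm
  · exact .univ_pi fun j => hts j ▸ .univ_pi fun i => hms j i

lemma map_sum_pi_gaussianReal {ι : Type*} [Fintype ι] (m : ι → ℝ) (J : Finset ι) :
    (Measure.pi fun i => gaussianReal (m i) 1).map (fun y => ∑ i ∈ J, y i) =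
      gaussianReal (∑ i ∈ J, m i) J.card := by
  classical
  have hind : iIndepFun (fun i (y : ι → ℝ) => y i) (Measure.pi fun i => gaussianReal (m i) 1) :=
    iIndepFun_pi (X := fun _ => id) fun _ => aemeasurable_id
  induction J using Finset.induction_on with
  | empty => simp
  | insert a s ha ih =>
    have h := gaussianReal_add_gaussianReal_of_indepFun
      (hind.indepFun_finsetSum_of_notMem (fun i => measurable_pi_apply i) ha)
      (by convert ih using 2; ext y; simp)
      ((measurePreserving_eval (fun i => gaussianReal (m i) 1) a).map_eq)
    rw [Finset.sum_insert ha, Finset.card_insert_of_notMem ha]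
    convert h using 1
    · congr 1; ext y; simp [Finset.sum_insert ha, add_comm]
    · rw [add_comm]; push_cast; rfl

/-- The normalized sums of the columns of a Gaussian matrix over the rows in `J` are independent
standard Gaussians, up to their means. -/
lemma map_normalized_colSum_Pmeas {d₁ d₂ : ℕ} (X : Fin d₁ → Fin d₂ → ℝ) {J : Finset (Fin d₁)}
    (hJ : 1 ≤ J.card) :
    (Pmeas d₁ d₂ X).map (fun Y j => 1 / Real.sqrt (J.card : ℝ) * ∑ i ∈ J, Y i j) =
      Measure.pi fun j => gaussianReal (1 / Real.sqrt (J.card : ℝ) * ∑ i ∈ J, X i j) 1 := by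
  have hcol : ∀ j, (Measure.pi fun i => gaussianReal (X i j) 1).map
      (fun y => 1 / Real.sqrt (J.card : ℝ) * ∑ i ∈ J, y i) =
      gaussianReal (1 / Real.sqrt (J.card : ℝ) * ∑ i ∈ J, X i j) 1 := by
    intro j
    have := Measure.map_map (μ := Measure.pi fun i => gaussianReal (X i j) 1)
      (f := fun y => ∑ i ∈ J, y i) (measurable_const_mul (1 / Real.sqrt (J.card : ℝ)))
      (by fun_prop)
    rw [map_sum_pi_gaussianReal, gaussianReal_map_const_mul] at this
    rw [Function.comp_def] at this
    rw [← this]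
    congr 1
    ext
    have : (J.card : ℝ) ≠ 0 := by positivity
    simp [this]
  have hsplit : (fun (Y : Fin d₁ → Fin d₂ → ℝ) j => 1 / Real.sqrt (J.card : ℝ) * ∑ i ∈ J, Y i j) =
      (fun Z j => 1 / Real.sqrt (J.card : ℝ) * ∑ i ∈ J, Z j i) ∘ fun Y j i => Y i j := rfl
  rw [hsplit, ← Measure.map_map (by fun_prop) (by fun_prop), Pmeas, pi_pi_map_flip,
    ← funext hcol]
  have : ∀ j, IsProbabilityMeasure ((Measure.pi fun i => gaussianReal (X i j) 1).map
      (fun y => 1 / Real.sqrt (J.card : ℝ) * ∑ i ∈ J, y i)) := fun j => by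
    rw [hcol]; infer_instance
  exact Measure.pi_map_pi (f := fun _ (y : Fin d₁ → ℝ) => 1 / Real.sqrt (J.card : ℝ) * ∑ i ∈ J, y i)
    fun j => by fun_prop

lemma integrable_exp_sq_div_four_gaussianReal :
    Integrable (fun z : ℝ => Real.exp (z ^ 2 / 4)) (gaussianReal 0 1) := by
  rw [gaussianReal_of_var_ne_zero _ one_ne_zero,
    integrable_withDensity_iff_integrable_smul' (measurable_gaussianPDF 0 1)
      (.of_forall fun _ => gaussianPDF_lt_top)]
  refine ((integrable_exp_neg_mul_sq (b := 1 / 4) (by norm_num)).const_mul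
    (Real.sqrt (2 * Real.pi))⁻¹).congr (.of_forall fun z => ?_)
  simp only [toReal_gaussianPDF, gaussianPDFReal, smul_eq_mul]
  rw [mul_assoc, ← Real.exp_add]
  simp only [NNReal.coe_one, mul_one]
  congr 2
  ring

/-- Gaussian tail bound for an exponential of the square, with the factor
`exp (-τ ^ 2 / 4)` that a Chernoff bound would give. -/
lemma setIntegral_exp_sq_div_four_gaussianReal_le {τ : ℝ} (hτ : 0 ≤ τ) :
    ∫ z in {z : ℝ | τ ≤ |z|}, Real.exp (z ^ 2 / 4) ∂(gaussianReal 0 1) ≤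
      3 * Real.exp (-τ ^ 2 / 4) := by
  have hm : MeasurableSet {z : ℝ | τ ≤ |z|} := measurableSet_le (by fun_prop) (by fun_prop)
  rw [← integral_indicator hm, integral_gaussianReal_eq_integral_smul one_ne_zero]
  have hpdf : ∀ m : ℝ, ∫ z, gaussianPDFReal m 2 z = 1 := fun m =>
    integral_gaussianPDFReal_eq_one m two_ne_zero
  have hint : Integrable fun z => Real.exp (-τ ^ 2 / 4) * Real.sqrt 2 *
      (gaussianPDFReal τ 2 z + gaussianPDFReal (-τ) 2 z) :=
    ((integrable_gaussianPDFReal τ 2).add (integrable_gaussianPDFReal (-τ) 2)).const_mul _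
  calc _ ≤ ∫ z, Real.exp (-τ ^ 2 / 4) * Real.sqrt 2 *
      (gaussianPDFReal τ 2 z + gaussianPDFReal (-τ) 2 z) := by
        refine integral_mono_of_nonneg (.of_forall fun z => ?_) hint (.of_forall fun z => ?_)
        · exact mul_nonneg (gaussianPDFReal_nonneg _ _ _)
            (Set.indicator_nonneg (fun _ _ => (Real.exp_pos _).le) _)
        · have hp := gaussianPDFReal_nonneg τ 2 z
          have hn := gaussianPDFReal_nonneg (-τ) 2 z
          have key : ∀ m : ℝ, τ ^ 2 = m ^ 2 → τ ^ 2 ≤ m * z →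
              gaussianPDFReal 0 1 z * Real.exp (z ^ 2 / 4) ≤
                Real.exp (-τ ^ 2 / 4) * Real.sqrt 2 * gaussianPDFReal m 2 z := by
            intro m h2 hmz
            have hs : Real.sqrt (2 * Real.pi * 2) = Real.sqrt 2 * Real.sqrt (2 * Real.pi) := by
              rw [mul_comm (2 * Real.pi), Real.sqrt_mul (by norm_num)]
            have h2' : Real.sqrt 2 ≠ 0 := by positivity
            simp only [gaussianPDFReal, NNReal.coe_one, NNReal.coe_ofNat, hs, mul_inv]
            have e : Real.exp (-τ ^ 2 / 4) * √2 * ((√2)⁻¹ * (√(2 * Real.pi))⁻¹ *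
                Real.exp (-(z - m) ^ 2 / (2 * 2))) = (√(2 * Real.pi))⁻¹ *
                Real.exp (-τ ^ 2 / 4 + -(z - m) ^ 2 / (2 * 2)) := by
              rw [Real.exp_add]; field_simp
            rw [mul_one, e, mul_assoc, ← Real.exp_add]
            exact mul_le_mul_of_nonneg_left (Real.exp_le_exp.2 (by nlinarith)) (by positivity)
          by_cases hz : τ ≤ |z|
          · simp only [Set.mem_ofPred_eq, hz, Set.indicator_of_mem, smul_eq_mul]
            have hc : 0 ≤ Real.exp (-τ ^ 2 / 4) * Real.sqrt 2 := by positivity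
            rcases le_abs.1 hz with h | h
            · have := key τ rfl (by nlinarith)
              nlinarith [mul_nonneg hc hn]
            · have := key (-τ) (by ring) (by nlinarith)
              nlinarith [mul_nonneg hc hp]
          · simp only [Set.mem_ofPred_eq, hz, not_false_eq_true, Set.indicator_of_notMem, smul_zero]
            positivity
    _ = Real.exp (-τ ^ 2 / 4) * Real.sqrt 2 * 2 := by
        rw [integral_const_mul, integral_add (integrable_gaussianPDFReal τ 2)
          (integrable_gaussianPDFReal (-τ) 2), hpdf, hpdf]; norm_num
    _ ≤ _ := by
        have : Real.sqrt 2 ≤ 3 / 2 := Real.sqrt_le_iff.2 (by norm_num)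
        nlinarith [Real.exp_pos (-τ ^ 2 / 4)]

lemma measureReal_tail_gaussianReal_pos (τ : ℝ) :
    0 < ((gaussianReal 0 1) {z : ℝ | τ < |z|}).toReal := by
  refine ENNReal.toReal_pos (fun h => ?_) (measure_ne_top _ _)
  have h0 := gaussianReal_absolutelyContinuous' 0 one_ne_zero
    (measure_mono_null (fun z (hz : τ < z) => hz.trans_le (le_abs_self z)) h :
      gaussianReal 0 1 (Set.Ioi τ) = 0)
  simp at h0

lemma integrable_sq_gaussianReal : Integrable (fun z : ℝ => z ^ 2) (gaussianReal 0 1) :=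
  (memLp_id_gaussianReal' 2 (by simp)).integrable_sq

lemma integrable_gaussianPDFReal_mul_sq :
    Integrable fun z : ℝ => gaussianPDFReal 0 1 z * z ^ 2 := by
  have h := integrable_sq_gaussianReal
  rw [gaussianReal_of_var_ne_zero _ one_ne_zero,
    integrable_withDensity_iff_integrable_smul' (measurable_gaussianPDF 0 1)
      (.of_forall fun _ => gaussianPDF_lt_top)] at h
  simp only [toReal_gaussianPDF, smul_eq_mul] at h
  exact h

lemma sq_le_nuTau {τ : ℝ} (hτ : 0 ≤ τ) : τ ^ 2 ≤ nuTau τ := by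
  have hm : MeasurableSet {z : ℝ | τ < |z|} := measurableSet_lt (by fun_prop) (by fun_prop)
  rw [nuTau, le_div_iff₀ (measureReal_tail_gaussianReal_pos τ)]
  have := setIntegral_ge_of_const_le_real (μ := gaussianReal 0 1) (f := fun z => z ^ 2)
    (c := τ ^ 2) hm (measure_ne_top _ _)
    (fun z (hz : τ < |z|) => by rw [← sq_abs z]; gcongr) integrable_sq_gaussianReal.integrableOn
  simpa [Measure.real] using this

/-- Beyond `τ`, the second moment of the Gaussian density is at most `τ ^ 2 + 2` times its mass. -/
lemma setIntegral_Ioi_gaussianPDFReal_mul_sq_sub_nonpos {τ : ℝ} (hτ : 0 < τ) :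
    ∫ z in Set.Ioi τ, gaussianPDFReal 0 1 z * (z ^ 2 - (τ ^ 2 + 2)) ≤ 0 := by
  set φ := gaussianPDFReal 0 1 with hφ
  have hφ0 : ∀ z, 0 ≤ φ z := gaussianPDFReal_nonneg 0 1
  have hφm : Measurable φ := measurable_gaussianPDFReal 0 1
  have hφi : Integrable φ := integrable_gaussianPDFReal 0 1
  have hφ2 : Integrable fun z => φ z * z ^ 2 := integrable_gaussianPDFReal_mul_sq
  have hdφ : ∀ z, HasDerivAt φ (-z * φ z) z := by
    intro z
    have h := (((hasDerivAt_id z).pow 2).neg.div_const 2).exp.const_mul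
      (Real.sqrt (2 * Real.pi))⁻¹
    have hφeq : φ = fun y => (√(2 * Real.pi))⁻¹ * Real.exp ((-id ^ 2 : ℝ → ℝ) y / 2) := by
      ext x; simp [hφ, gaussianPDFReal]
    rw [hφeq]
    refine h.congr_deriv ?_
    simp only [Pi.neg_apply, Pi.pow_apply, id, Nat.cast_ofNat]
    ring
  set F' : ℝ → ℝ := fun z => φ z * (z ^ 2 - τ ^ 2 - 1 - τ ^ 2 / z ^ 2) with hF'
  have hratio : ∀ z ∈ Set.Ioi τ, τ ^ 2 / z ^ 2 ≤ 1 := fun z (hz : τ < z) =>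
    div_le_one_of_le₀ (by gcongr) (by positivity)
  -- `(τ ^ 2 / z - z) φ(z)` is an antiderivative of a pointwise larger function
  have hderiv : ∀ z ∈ Set.Ici τ, HasDerivAt (fun z => (τ ^ 2 / z - z) * φ z) (F' z) z := by
    intro z hz
    have hz0 : z ≠ 0 := (hτ.trans_le hz).ne'
    have h := (((hasDerivAt_inv hz0).const_mul (τ ^ 2)).sub (hasDerivAt_id z)).mul (hdφ z)
    refine (h.congr_deriv ?_).congr_of_eventuallyEq (.of_forall fun x => ?_)
    · simp only [hF', id, Pi.sub_apply]
      field_simp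
      ring
    · simp [div_eq_mul_inv]
  have hF'i : IntegrableOn F' (Set.Ioi τ) := by
    have hg : Integrable fun z => φ z * z ^ 2 + (τ ^ 2 + 2) * φ z := hφ2.add (hφi.const_mul _)
    refine hg.restrict.mono' (by fun_prop) ?_
    filter_upwards [ae_restrict_mem measurableSet_Ioi] with z hz
    have h1 := hratio z hz
    have h2 : 0 ≤ τ ^ 2 / z ^ 2 := by positivity
    rw [Real.norm_eq_abs, abs_mul, abs_of_nonneg (hφ0 z)]
    have : |z ^ 2 - τ ^ 2 - 1 - τ ^ 2 / z ^ 2| ≤ z ^ 2 + (τ ^ 2 + 2) :=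
      abs_le.2 ⟨by nlinarith, by nlinarith⟩
    nlinarith [mul_le_mul_of_nonneg_left this (hφ0 z)]
  have hFi : IntegrableOn (fun z => (τ ^ 2 / z - z) * φ z) (Set.Ioi τ) := by
    have hg : Integrable fun z => φ z * z ^ 2 + (τ + 1) * φ z := hφ2.add (hφi.const_mul _)
    refine hg.restrict.mono' (by fun_prop) ?_
    filter_upwards [ae_restrict_mem measurableSet_Ioi] with z hz
    have hz' : τ < z := hz
    have h1 : τ ^ 2 / z ≤ τ := by rw [div_le_iff₀ (hτ.trans hz')]; nlinarith
    have h2 : 0 ≤ τ ^ 2 / z := div_nonneg (sq_nonneg _) (hτ.trans hz').le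
    rw [Real.norm_eq_abs, abs_mul, abs_of_nonneg (hφ0 z)]
    have : |τ ^ 2 / z - z| ≤ z ^ 2 + (τ + 1) :=
      abs_le.2 ⟨by nlinarith [sq_nonneg (z - 1)], by nlinarith⟩
    nlinarith [mul_le_mul_of_nonneg_left this (hφ0 z)]
  have hzero : ∫ z in Set.Ioi τ, F' z = 0 := by
    rw [integral_Ioi_of_hasDerivAt_of_tendsto' hderiv hF'i
      (tendsto_zero_of_hasDerivAt_of_integrableOn_Ioi
        (fun z hz => hderiv z (Set.Ioi_subset_Ici_self hz)) hF'i hFi)]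
    field_simp
    ring
  rw [← hzero]
  refine setIntegral_mono_on ?_ hF'i measurableSet_Ioi fun z hz => ?_
  · refine ((hφ2.sub (hφi.const_mul (τ ^ 2 + 2))).congr (.of_forall fun z => ?_)).integrableOn
    simp only [Pi.sub_apply]; ring
  · exact mul_le_mul_of_nonneg_left (by linarith [hratio z hz]) (hφ0 z)

lemma nuTau_le {τ : ℝ} (hτ : 0 < τ) : nuTau τ ≤ τ ^ 2 + 2 := by
  have hm : MeasurableSet {z : ℝ | τ < |z|} := measurableSet_lt (by fun_prop) (by fun_prop)
  rw [nuTau, div_le_iff₀ (measureReal_tail_gaussianReal_pos τ), ← sub_nonpos]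
  have hsub : ∫ z in {z : ℝ | τ < |z|}, (z ^ 2 - (τ ^ 2 + 2)) ∂(gaussianReal 0 1) =
      (∫ z in {z : ℝ | τ < |z|}, z ^ 2 ∂(gaussianReal 0 1)) -
        (τ ^ 2 + 2) * ((gaussianReal 0 1) {z : ℝ | τ < |z|}).toReal := by
    rw [integral_sub integrable_sq_gaussianReal.integrableOn (integrable_const _)]
    simp [Measure.real, mul_comm]
  rw [← hsub, ← integral_indicator hm, integral_gaussianReal_eq_integral_smul one_ne_zero]
  have habs : ∀ z : ℝ, gaussianPDFReal 0 1 z • Set.indicator {z : ℝ | τ < |z|}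
      (fun z => z ^ 2 - (τ ^ 2 + 2)) z = (fun x => Set.indicator (Set.Ioi τ)
        (fun x => gaussianPDFReal 0 1 x * (x ^ 2 - (τ ^ 2 + 2))) x) |z| := by
    intro z
    by_cases hz : τ < |z| <;> simp [hz, gaussianPDFReal]
  simp_rw [habs]
  rw [integral_comp_abs (f := fun x => Set.indicator (Set.Ioi τ)
        (fun x => gaussianPDFReal 0 1 x * (x ^ 2 - (τ ^ 2 + 2))) x),
    setIntegral_indicator measurableSet_Ioi, Set.Ioi_inter_Ioi, max_eq_right hτ.le]
  linarith [setIntegral_Ioi_gaussianPDFReal_mul_sq_sub_nonpos hτ]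

/-- The summand of the truncated chi-square statistic. -/
noncomputable def truncatedSq (τ z : ℝ) : ℝ :=
  (z ^ 2 - nuTau τ) * (if τ < |z| then (1 : ℝ) else 0)

lemma truncatedSq_eq_indicator (τ : ℝ) :
    truncatedSq τ = Set.indicator {z : ℝ | τ < |z|} fun z => z ^ 2 - nuTau τ := by
  ext z
  by_cases hz : τ < |z| <;> simp [truncatedSq, hz]

lemma measurable_truncatedSq (τ : ℝ) : Measurable (truncatedSq τ) := by
  rw [truncatedSq_eq_indicator]
  exact Measurable.indicator (by fun_prop) (measurableSet_lt (by fun_prop) (by fun_prop))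

lemma sq_sub_nuTau_le_truncatedSq {τ : ℝ} (hτ : 0 ≤ τ) (z : ℝ) :
    z ^ 2 - nuTau τ ≤ truncatedSq τ z := by
  by_cases hz : τ < |z|
  · simp [truncatedSq, hz]
  · have : z ^ 2 ≤ τ ^ 2 := by rw [← sq_abs z]; gcongr; exact not_lt.1 hz
    simpa [truncatedSq, hz] using this.trans (sq_le_nuTau hτ)

lemma abs_truncatedSq_le {τ z : ℝ} (hτ : 0 < τ) (hz : τ < |z|) :
    |truncatedSq τ z| ≤ z ^ 2 - τ ^ 2 + 2 := by
  have h1 := sq_le_nuTau hτ.le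
  have h2 := nuTau_le hτ
  have h3 : τ ^ 2 ≤ z ^ 2 := by rw [← sq_abs z]; gcongr
  simp only [truncatedSq, hz, if_true, mul_one]
  exact abs_le.2 ⟨by linarith, by linarith⟩

lemma integrable_truncatedSq (τ : ℝ) : Integrable (truncatedSq τ) (gaussianReal 0 1) := by
  rw [truncatedSq_eq_indicator]
  exact (integrable_sq_gaussianReal.sub (integrable_const _)).indicator
    (measurableSet_lt (by fun_prop) (by fun_prop))

lemma integral_truncatedSq (τ : ℝ) : ∫ z, truncatedSq τ z ∂(gaussianReal 0 1) = 0 := by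
  rw [truncatedSq_eq_indicator, integral_indicator (measurableSet_lt (by fun_prop) (by fun_prop)),
    integral_sub integrable_sq_gaussianReal.integrableOn (integrable_const _), nuTau]
  have := (measureReal_tail_gaussianReal_pos τ).ne'
  rw [integral_const, measureReal_restrict_apply_univ, measureReal_def, smul_eq_mul]
  field_simp
  ring

lemma exp_mul_le_one_add_add_sq {l w : ℝ} (hl : |l| ≤ 1 / 8) :
    Real.exp (l * w) ≤ 1 + l * w + 128 * l ^ 2 * Real.exp (|w| / 4) := by
  have h1 : Real.exp (l * w) - (1 + l * w) ≤ (l * w) ^ 2 * Real.exp |l * w| := by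
    have h := Complex.norm_exp_sub_sum_le_norm_mul_exp ((l * w : ℝ) : ℂ) 2
    simp only [Finset.sum_range_succ, Finset.sum_range_zero, pow_zero, pow_one, Nat.factorial,
      Nat.cast_one, div_one, zero_add, Complex.norm_real, Real.norm_eq_abs, sq_abs] at h
    rw [← Complex.ofReal_exp, mul_one, Nat.cast_one, div_one, ← Complex.ofReal_one,
      ← Complex.ofReal_add, ← Complex.ofReal_sub, Complex.norm_real] at h
    exact (le_abs_self _).trans h
  have h2 : |l * w| ≤ |w| / 8 := by
    rw [abs_mul]; nlinarith [abs_nonneg w]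
  have h3 : w ^ 2 ≤ 128 * Real.exp (|w| / 8) := by
    have := Real.quadratic_le_exp_of_nonneg (x := |w| / 8) (by positivity)
    nlinarith [abs_nonneg w, sq_abs w]
  have h4 : Real.exp (|w| / 4) = Real.exp (|w| / 8) * Real.exp (|w| / 8) := by
    rw [← Real.exp_add]; ring_nf
  have h5 : Real.exp |l * w| ≤ Real.exp (|w| / 8) := Real.exp_le_exp.2 h2
  calc Real.exp (l * w) ≤ 1 + l * w + l ^ 2 * (w ^ 2 * Real.exp |l * w|) := by
        linarith [mul_pow l w 2]
    _ ≤ 1 + l * w + l ^ 2 * (128 * Real.exp (|w| / 8) * Real.exp (|w| / 8)) := by gcongr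
    _ = _ := by rw [h4]; ring

lemma exp_abs_truncatedSq_div_four_le {τ : ℝ} (hτ : 0 < τ) (z : ℝ) :
    Real.exp (|truncatedSq τ z| / 4) ≤ Real.exp (1 / 2) * Real.exp (z ^ 2 / 4) := by
  rw [← Real.exp_add, Real.exp_le_exp]
  by_cases hz : τ < |z|
  · nlinarith [abs_truncatedSq_le hτ hz]
  · simp only [truncatedSq, hz, if_false, mul_zero, abs_zero]
    linarith [sq_nonneg z]

lemma integrable_exp_mul_truncatedSq {τ l : ℝ} (hτ : 0 < τ) (hl : |l| ≤ 1 / 8) :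
    Integrable (fun z => Real.exp (l * truncatedSq τ z)) (gaussianReal 0 1) := by
  refine (integrable_exp_sq_div_four_gaussianReal.const_mul (Real.exp (1 / 2))).mono'
    (((measurable_truncatedSq τ).const_mul l).exp.aestronglyMeasurable) (.of_forall fun z => ?_)
  rw [Real.norm_eq_abs, Real.abs_exp]
  refine (Real.exp_le_exp.2 ?_).trans (exp_abs_truncatedSq_div_four_le hτ z)
  calc _ ≤ |l| * |truncatedSq τ z| := (le_abs_self _).trans (abs_mul _ _).le
    _ ≤ _ := by nlinarith [abs_nonneg (truncatedSq τ z)]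

/-- Sub-Gaussian type bound for the truncated square, proportional to the tail probability. -/
lemma integral_exp_mul_truncatedSq_le {τ l : ℝ} (hτ : 0 < τ) (hl : |l| ≤ 1 / 8) :
    ∫ z, Real.exp (l * truncatedSq τ z) ∂(gaussianReal 0 1) ≤
      Real.exp (768 * l ^ 2 * Real.exp (-τ ^ 2 / 2)) := by
  have hm : MeasurableSet {z : ℝ | τ ≤ |z|} := measurableSet_le (by fun_prop) (by fun_prop)
  have hE : Integrable (fun z : ℝ => Set.indicator {z : ℝ | τ ≤ |z|}
      (fun z => Real.exp (z ^ 2 / 4)) z) (gaussianReal 0 1) :=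
    integrable_exp_sq_div_four_gaussianReal.indicator hm
  set C := 128 * l ^ 2 * (Real.exp (1 / 2) * Real.exp (-τ ^ 2 / 4)) with hC
  have hpt : ∀ z, Real.exp (l * truncatedSq τ z) ≤ 1 + l * truncatedSq τ z +
      C * Set.indicator {z : ℝ | τ ≤ |z|} (fun z => Real.exp (z ^ 2 / 4)) z := by
    intro z
    by_cases hz : τ < |z|
    · have h := exp_mul_le_one_add_add_sq (w := truncatedSq τ z) hl
      have hw : Real.exp (|truncatedSq τ z| / 4) ≤
          Real.exp (1 / 2) * Real.exp (-τ ^ 2 / 4) * Real.exp (z ^ 2 / 4) := by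
        rw [← Real.exp_add, ← Real.exp_add, Real.exp_le_exp]
        linarith [abs_truncatedSq_le hτ hz]
      have hz' : z ∈ {z : ℝ | τ ≤ |z|} := hz.le
      rw [Set.indicator_of_mem hz', hC]
      have := mul_le_mul_of_nonneg_left hw (by positivity : 0 ≤ 128 * l ^ 2)
      linarith
    · simp only [truncatedSq, hz, if_false, mul_zero, Real.exp_zero, add_zero]
      have : 0 ≤ Set.indicator {z : ℝ | τ ≤ |z|} (fun z => Real.exp (z ^ 2 / 4)) z :=
        Set.indicator_nonneg (fun _ _ => (Real.exp_pos _).le) _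
      have : 0 ≤ C := by positivity
      nlinarith
  have h1 : Integrable (fun z => 1 + l * truncatedSq τ z) (gaussianReal 0 1) :=
    (integrable_const 1).add ((integrable_truncatedSq τ).const_mul l)
  calc _ ≤ ∫ z, (1 + l * truncatedSq τ z + C * Set.indicator {z : ℝ | τ ≤ |z|}
        (fun z => Real.exp (z ^ 2 / 4)) z) ∂(gaussianReal 0 1) :=
        integral_mono (integrable_exp_mul_truncatedSq hτ hl) (h1.add (hE.const_mul C)) hpt
    _ = 1 + C * ∫ z in {z : ℝ | τ ≤ |z|}, Real.exp (z ^ 2 / 4) ∂(gaussianReal 0 1) := by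
        rw [integral_add h1 (hE.const_mul C), integral_add (integrable_const 1)
          ((integrable_truncatedSq τ).const_mul l), integral_const_mul, integral_const_mul,
          integral_truncatedSq, integral_indicator hm]
        simp
    _ ≤ 1 + C * (3 * Real.exp (-τ ^ 2 / 4)) := by
        have := setIntegral_exp_sq_div_four_gaussianReal_le hτ.le
        gcongr
    _ ≤ 1 + 768 * l ^ 2 * Real.exp (-τ ^ 2 / 2) := by
        have e : Real.exp (-τ ^ 2 / 2) = Real.exp (-τ ^ 2 / 4) * Real.exp (-τ ^ 2 / 4) := by
          rw [← Real.exp_add]; ring_nf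
        have h2 : Real.exp (1 / 2) ≤ 2 := by
          rw [← Real.le_log_iff_exp_le (by norm_num)]
          linarith [Real.log_two_gt_d9]
        rw [hC, e]
        have : 0 ≤ l ^ 2 * (Real.exp (-τ ^ 2 / 4) * Real.exp (-τ ^ 2 / 4)) := by positivity
        nlinarith
    _ ≤ _ := by linarith [Real.add_one_le_exp (768 * l ^ 2 * Real.exp (-τ ^ 2 / 2))]

lemma integrable_exp_mul_sq_sub_gaussianReal {l : ℝ} (hl : l ≤ 1 / 4) (m : ℝ) :
    Integrable (fun z => Real.exp (l * (z - m) ^ 2)) (gaussianReal m 1) := by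
  have hmap : gaussianReal m 1 = (gaussianReal 0 1).map (· + m) := by
    rw [gaussianReal_map_add_const, zero_add]
  rw [hmap, integrable_map_measure (by fun_prop) (by fun_prop)]
  refine integrable_exp_sq_div_four_gaussianReal.mono' (by fun_prop) (.of_forall fun z => ?_)
  simp only [Function.comp_apply, add_sub_cancel_right, Real.norm_eq_abs, Real.abs_exp]
  exact Real.exp_le_exp.2 (by nlinarith [sq_nonneg z])

lemma integral_exp_mul_sq_sub_gaussianReal_le {l : ℝ} (hl0 : 0 ≤ l) (hl : l ≤ 1 / 8) (m : ℝ) :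
    ∫ z, Real.exp (l * (z - m) ^ 2) ∂(gaussianReal m 1) ≤ Real.exp (24 * l) := by
  have hmap : gaussianReal m 1 = (gaussianReal 0 1).map (· + m) := by
    rw [gaussianReal_map_add_const, zero_add]
  rw [hmap, integral_map (by fun_prop) (by fun_prop)]
  simp only [add_sub_cancel_right]
  have hi := integrable_exp_mul_sq_sub_gaussianReal (hl.trans (by norm_num)) 0
  simp only [sub_zero] at hi
  have hpt : ∀ z : ℝ, Real.exp (l * z ^ 2) ≤ 1 + 8 * l * Real.exp (z ^ 2 / 4) := by
    intro z
    have h := convexOn_exp.2 (Set.mem_univ 0) (Set.mem_univ (z ^ 2 / 8))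
      (by linarith : 0 ≤ 1 - 8 * l) (by linarith : 0 ≤ 8 * l) (by ring)
    simp only [smul_eq_mul, mul_zero, zero_add, Real.exp_zero, mul_one] at h
    have h2 : Real.exp (z ^ 2 / 8) ≤ Real.exp (z ^ 2 / 4) :=
      Real.exp_le_exp.2 (by nlinarith [sq_nonneg z])
    rw [show 8 * l * (z ^ 2 / 8) = l * z ^ 2 by ring] at h
    nlinarith
  have hle := setIntegral_exp_sq_div_four_gaussianReal_le le_rfl
  simp only [abs_nonneg, Set.ofPred_true, setIntegral_univ] at hle
  calc _ ≤ ∫ z, (1 + 8 * l * Real.exp (z ^ 2 / 4)) ∂(gaussianReal 0 1) :=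
        integral_mono hi ((integrable_const 1).add
          (integrable_exp_sq_div_four_gaussianReal.const_mul _)) hpt
    _ = 1 + 8 * l * ∫ z, Real.exp (z ^ 2 / 4) ∂(gaussianReal 0 1) := by
        rw [integral_add (integrable_const 1)
          (integrable_exp_sq_div_four_gaussianReal.const_mul _), integral_const_mul]
        simp
    _ ≤ 1 + 8 * l * 3 := by
        norm_num at hle
        gcongr
    _ ≤ _ := by linarith [Real.add_one_le_exp (24 * l)]

/-- Chernoff bound for a sum of functions of independent coordinates. -/
lemma measureReal_pi_le_sum_le_exp {κ : Type*} [Fintype κ] (P : κ → Measure ℝ)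
    [∀ j, IsProbabilityMeasure (P j)] {f : κ → ℝ → ℝ} {b : κ → ℝ}
    (hi : ∀ j, Integrable (fun z => Real.exp (f j z)) (P j))
    (hb : ∀ j, ∫ z, Real.exp (f j z) ∂(P j) ≤ Real.exp (b j)) (t : ℝ) :
    (Measure.pi P).real {z | t ≤ ∑ j, f j (z j)} ≤ Real.exp (∑ j, b j - t) := by
  have h := mul_meas_ge_le_integral_of_nonneg (μ := Measure.pi P)
    (f := fun z => ∏ j, Real.exp (f j (z j))) (.of_forall fun z => by positivity)
    (Integrable.fintype_prod_dep hi) (Real.exp t)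
  rw [integral_fintype_prod_eq_prod (f := fun j z => Real.exp (f j z))] at h
  simp only [← Real.exp_sum, Real.exp_le_exp] at h
  have h2 : ∏ j, ∫ z, Real.exp (f j z) ∂(P j) ≤ Real.exp (∑ j, b j) := by
    rw [Real.exp_sum]
    exact Finset.prod_le_prod (fun j _ => integral_nonneg fun _ => (Real.exp_pos _).le)
      fun j _ => hb j
  rw [Real.exp_sub, le_div_iff₀ (Real.exp_pos t), mul_comm]
  exact h.trans h2

/-- Upper tail of the truncated chi-square statistic of a standard Gaussian vector. -/
lemma measureReal_pi_lt_sum_truncatedSq_le {d : ℕ} {τ L s B T : ℝ} (hτ : 0 < τ) (hL : 0 < L)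
    (hs : 0 < s) (hd : d * Real.exp (-τ ^ 2 / 2) ≤ s ^ 2 / L)
    (hTL : 8 * B * L ≤ T) (hTs : 8 * B * s ≤ T) :
    (Measure.pi fun _ : Fin d => gaussianReal 0 1).real {z | T < ∑ j, truncatedSq τ (z j)} ≤
      Real.exp (12 * L - B * L) := by
  set l := min 1 (L / s) / 8 with hl
  have hm0 : 0 < min 1 (L / s) := lt_min one_pos (by positivity)
  have hl0 : 0 < l := by positivity
  have hl8 : |l| ≤ 1 / 8 := by
    rw [abs_of_pos hl0, hl]; linarith [min_le_left 1 (L / s)]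
  have hls : l * s ≤ L / 8 := by
    have := (le_div_iff₀ hs).1 (min_le_right 1 (L / s))
    rw [hl]; linarith
  have hlT : B * L ≤ l * T := by
    rcases min_choice 1 (L / s) with h | h
    · rw [hl, h]; linarith
    · rw [hl, h]
      calc B * L = L / s / 8 * (8 * B * s) := by field_simp
        _ ≤ _ := by gcongr
  have hcher := measureReal_pi_le_sum_le_exp (fun _ : Fin d => gaussianReal 0 1)
    (f := fun _ z => l * truncatedSq τ z) (fun _ => integrable_exp_mul_truncatedSq hτ hl8)
    (fun _ => integral_exp_mul_truncatedSq_le hτ hl8) (l * T)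
  refine (measureReal_mono fun z hz => ?_).trans (hcher.trans (Real.exp_le_exp.2 ?_))
  · change l * T ≤ ∑ j, l * truncatedSq τ (z j)
    rw [← Finset.mul_sum]
    exact mul_le_mul_of_nonneg_left (le_of_lt hz) hl0.le
  · have h1 : l ^ 2 * (d * Real.exp (-τ ^ 2 / 2)) ≤ L / 64 :=
      calc _ ≤ l ^ 2 * (s ^ 2 / L) := by gcongr
        _ = (l * s) ^ 2 / L := by ring
        _ ≤ (L / 8) ^ 2 / L := by gcongr
        _ = L / 64 := by field_simp; norm_num
    simp only [Finset.sum_const, Finset.card_univ, Fintype.card_fin, nsmul_eq_mul]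
    linarith

/-- Lower tail of the truncated chi-square statistic of a Gaussian vector whose mean is supported
on `S` and large there. -/
lemma measureReal_pi_sum_truncatedSq_le_le {d : ℕ} {θ : Fin d → ℝ} {S : Finset (Fin d)}
    {τ L m R T : ℝ} (hτ : 0 < τ) (hS : 1 ≤ S.card) (hm : 0 ≤ m)
    (hθ : ∀ j ∈ S, m ≤ θ j) (hθ0 : ∀ j ∉ S, θ j = 0)
    (hd : d * Real.exp (-τ ^ 2 / 2) ≤ (S.card : ℝ) ^ 2 / L)
    (hT : T + R * S.card ≤ S.card * (m ^ 2 / 2 - nuTau τ)) :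
    (Measure.pi fun j => gaussianReal (θ j) 1).real {z | ∑ j, truncatedSq τ (z j) ≤ T} ≤
      Real.exp (3 + 12 / L - R / 8) := by
  classical
  have hs1 : (1 : ℝ) ≤ S.card := by exact_mod_cast hS
  set s : ℝ := (S.card : ℝ) with hs
  have hs0 : 0 < s := by linarith
  set l := 1 / (8 * s) with hl
  have hl0 : 0 < l := by positivity
  have hls : l * s = 1 / 8 := by rw [hl]; field_simp
  have hl8 : l ≤ 1 / 8 := by rw [← hls]; nlinarith
  have hl8' : |-l| ≤ 1 / 8 := by rwa [abs_neg, abs_of_pos hl0]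
  have hcher := measureReal_pi_le_sum_le_exp (fun j => gaussianReal (θ j) 1)
    (f := fun j z => if j ∈ S then l * (z - θ j) ^ 2 else -l * truncatedSq τ z)
    (b := fun j => if j ∈ S then 24 * l else 768 * (-l) ^ 2 * Real.exp (-τ ^ 2 / 2))
    (fun j => by
      by_cases hj : j ∈ S
      · simpa only [hj, if_true] using
          integrable_exp_mul_sq_sub_gaussianReal (hl8.trans (by norm_num)) (θ j)
      · simpa only [hj, if_false, hθ0 j hj] using integrable_exp_mul_truncatedSq hτ hl8')
    (fun j => by
      by_cases hj : j ∈ S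
      · simpa only [hj, if_true] using
          integral_exp_mul_sq_sub_gaussianReal_le hl0.le hl8 (θ j)
      · simpa only [hj, if_false, hθ0 j hj] using integral_exp_mul_truncatedSq_le hτ hl8')
    (R / 8)
  refine (measureReal_mono fun z hz => ?_).trans (hcher.trans (Real.exp_le_exp.2 ?_))
  · have hz' : ∑ j, truncatedSq τ (z j) ≤ T := hz
    have hpt : ∀ j, (if j ∈ S then l * (m ^ 2 / 2 - nuTau τ) else 0) - l * truncatedSq τ (z j) ≤
        if j ∈ S then l * (z j - θ j) ^ 2 else -l * truncatedSq τ (z j) := by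
      intro j
      by_cases hj : j ∈ S
      · simp only [hj, if_true]
        have h1 := sq_sub_nuTau_le_truncatedSq hτ.le (z j)
        have h2 : m ^ 2 ≤ θ j ^ 2 := by have := hθ j hj; gcongr
        rw [← mul_sub]
        refine mul_le_mul_of_nonneg_left ?_ hl0.le
        nlinarith [sq_nonneg (θ j + 2 * (z j - θ j))]
      · simp [hj]
    change R / 8 ≤ ∑ j, if j ∈ S then l * (z j - θ j) ^ 2 else -l * truncatedSq τ (z j)
    refine le_trans ?_ (Finset.sum_le_sum fun j _ => hpt j)
    rw [Finset.sum_sub_distrib, ← Finset.mul_sum, Finset.sum_ite_mem, Finset.univ_inter,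
      Finset.sum_const, nsmul_eq_mul, ← hs]
    have h3 := mul_le_mul_of_nonneg_left hT hl0.le
    have h4 := mul_le_mul_of_nonneg_left hz' hl0.le
    have h5 : R / 8 = R * (l * s) := by rw [hls]; ring
    linarith
  · have h1 : ∑ j, (if j ∈ S then 24 * l else 768 * (-l) ^ 2 * Real.exp (-τ ^ 2 / 2)) ≤
        ∑ j, ((if j ∈ S then 24 * l else 0) + 768 * l ^ 2 * Real.exp (-τ ^ 2 / 2)) := by
      refine Finset.sum_le_sum fun j _ => ?_
      by_cases hj : j ∈ S
      · simp only [hj, if_true]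
        linarith [show 0 ≤ 768 * l ^ 2 * Real.exp (-τ ^ 2 / 2) by positivity]
      · simp [hj]
    rw [Finset.sum_add_distrib, Finset.sum_ite_mem, Finset.univ_inter, Finset.sum_const,
      Finset.sum_const, nsmul_eq_mul, nsmul_eq_mul, ← hs, Finset.card_univ,
      Fintype.card_fin] at h1
    have h2 : l ^ 2 * (d * Real.exp (-τ ^ 2 / 2)) ≤ 1 / 64 / L :=
      calc _ ≤ l ^ 2 * (s ^ 2 / L) := by gcongr
        _ = (l * s) ^ 2 / L := by ring
        _ = 1 / 64 / L := by rw [hls]; norm_num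
    have h3 : 12 / L = 768 * (1 / 64 / L) := by ring
    have h4 : s * (24 * l) = 3 := by linarith
    linarith

instance (d₁ d₂ : ℕ) (X : Fin d₁ → Fin d₂ → ℝ) : IsProbabilityMeasure (Pmeas d₁ d₂ X) := by
  unfold Pmeas; infer_instance

/-- The truncated chi-square statistic of the normalized column sums over the rows in `J`. -/
noncomputable def colSumStat {d₁ d₂ : ℕ} (s₁ : ℕ) (τ : ℝ) (J : Finset (Fin d₁))
    (Y : Fin d₁ → Fin d₂ → ℝ) : ℝ :=
  ∑ j, truncatedSq τ ((1 / Real.sqrt (s₁ : ℝ)) * ∑ i ∈ J, Y i j)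

lemma measurable_sum_truncatedSq (d : ℕ) (τ : ℝ) :
    Measurable fun z : Fin d → ℝ => ∑ j, truncatedSq τ (z j) :=
  Finset.measurable_fun_sum _ fun j _ => (measurable_truncatedSq τ).comp (measurable_pi_apply j)

lemma measureReal_Pmeas_colSumStat {d₁ d₂ s₁ : ℕ} (τ : ℝ) {J : Finset (Fin d₁)} (hs₁ : 1 ≤ s₁)
    (hJ : J.card = s₁) (X : Fin d₁ → Fin d₂ → ℝ) {A : Set ℝ} (hA : MeasurableSet A) :
    (Pmeas d₁ d₂ X).real {Y | colSumStat s₁ τ J Y ∈ A} =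
      (Measure.pi fun j => gaussianReal (1 / Real.sqrt (s₁ : ℝ) * ∑ i ∈ J, X i j) 1).real
        {z | ∑ j, truncatedSq τ (z j) ∈ A} := by
  subst hJ
  have hA' : MeasurableSet {z : Fin d₂ → ℝ | ∑ j, truncatedSq τ (z j) ∈ A} :=
    measurable_sum_truncatedSq d₂ τ hA
  rw [← map_normalized_colSum_Pmeas X hs₁, measureReal_def, measureReal_def,
    Measure.map_apply (by fun_prop) hA']
  rfl

lemma risk_le {d₁ d₂ s₁ s₂ : ℕ} {μ a b : ℝ} {Δ : (Fin d₁ → Fin d₂ → ℝ) → Bool} (hb : 0 ≤ b)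
    (h₀ : (Pmeas d₁ d₂ 0).real {y | Δ y = true} ≤ a)
    (h₁ : ∀ X ∈ Theta d₁ d₂ s₁ s₂ μ, (Pmeas d₁ d₂ X).real {y | Δ y = false} ≤ b) :
    risk d₁ d₂ s₁ s₂ μ Δ ≤ a + b :=
  add_le_add h₀ (Real.iSup_le (fun X => Real.iSup_le (h₁ X) hb) hb)

/-- The event that the maximal statistic exceeds `T`, bounded by a union over the row sets. -/
lemma measureReal_Pmeas_lt_iSup_colSumStat_le {d₁ d₂ s₁ : ℕ} {τ T p : ℝ}
    (X : Fin d₁ → Fin d₂ → ℝ) (hT : 0 ≤ T)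
    (hp : ∀ J ∈ (Finset.univ : Finset (Fin d₁)).powersetCard s₁,
      (Pmeas d₁ d₂ X).real {Y | colSumStat s₁ τ J Y ∈ Set.Ioi T} ≤ p) :
    (Pmeas d₁ d₂ X).real {Y | T < ⨆ J ∈ (Finset.univ : Finset (Fin d₁)).powersetCard s₁,
      colSumStat s₁ τ J Y} ≤ d₁.choose s₁ * p := by
  have hsub : {Y : Fin d₁ → Fin d₂ → ℝ | T < ⨆ J ∈ Finset.univ.powersetCard s₁,
      colSumStat s₁ τ J Y} ⊆ ⋃ J ∈ Finset.univ.powersetCard s₁,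
        {Y | colSumStat s₁ τ J Y ∈ Set.Ioi T} := by
    intro Y hY
    by_contra hcon
    simp only [Set.mem_iUnion, Set.mem_ofPred_eq, Set.mem_Ioi, not_exists, not_lt] at hcon
    exact not_le.2 hY (Real.iSup_le (fun J => Real.iSup_le (hcon J) hT) hT)
  calc _ ≤ _ := measureReal_mono hsub (measure_ne_top _ _)
    _ ≤ _ := measureReal_biUnion_finset_le _ _
    _ ≤ ∑ J ∈ (Finset.univ : Finset (Fin d₁)).powersetCard s₁, p := Finset.sum_le_sum hp
    _ = _ := by
        rw [Finset.sum_const, Finset.card_powersetCard, Finset.card_univ, Fintype.card_fin,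
          nsmul_eq_mul]

lemma colSumStat_le_iSup {d₁ d₂ s₁ : ℕ} (τ : ℝ) {S : Finset (Fin d₁)} (hS : S.card = s₁)
    (Y : Fin d₁ → Fin d₂ → ℝ) :
    colSumStat s₁ τ S Y ≤ ⨆ J ∈ (Finset.univ : Finset (Fin d₁)).powersetCard s₁,
      colSumStat s₁ τ J Y := by
  have hmem : S ∈ (Finset.univ : Finset (Fin d₁)).powersetCard s₁ :=
    Finset.mem_powersetCard.2 ⟨Finset.subset_univ _, hS⟩
  refine le_trans (le_of_eq ?_) (le_ciSup (Set.finite_range _).bddAbove S)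
  exact (ciSup_pos (f := fun _ => colSumStat s₁ τ S Y) hmem).symm

/-- If the mean matrix lies in `Theta`, the maximal statistic is unlikely to be at most `T`. -/
lemma measureReal_Pmeas_iSup_colSumStat_le_le {d₁ d₂ s₁ s₂ : ℕ} {τ μ L R T : ℝ}
    {X : Fin d₁ → Fin d₂ → ℝ} (hX : X ∈ Theta d₁ d₂ s₁ s₂ μ) (hτ : 0 < τ)
    (hs₁ : 1 ≤ s₁) (hs₂ : 1 ≤ s₂) (hμ : 0 ≤ μ)
    (hd : d₂ * Real.exp (-τ ^ 2 / 2) ≤ (s₂ : ℝ) ^ 2 / L)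
    (hT : T + R * s₂ ≤ s₂ * (s₁ * μ ^ 2 / 2 - nuTau τ)) :
    (Pmeas d₁ d₂ X).real {Y | ⨆ J ∈ (Finset.univ : Finset (Fin d₁)).powersetCard s₁,
      colSumStat s₁ τ J Y ≤ T} ≤ Real.exp (3 + 12 / L - R / 8) := by
  obtain ⟨S₁, S₂, hS₁, rfl, hin, hout⟩ := hX
  have hsub : {Y : Fin d₁ → Fin d₂ → ℝ | ⨆ J ∈ (Finset.univ : Finset (Fin d₁)).powersetCard s₁,
      colSumStat s₁ τ J Y ≤ T} ⊆ {Y | colSumStat s₁ τ S₁ Y ∈ Set.Iic T} :=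
    fun Y hY => (colSumStat_le_iSup τ hS₁ Y).trans hY
  refine (measureReal_mono hsub (measure_ne_top _ _)).trans ?_
  rw [measureReal_Pmeas_colSumStat τ hs₁ hS₁ X measurableSet_Iic]
  have hmean : ∀ j ∈ S₂, Real.sqrt s₁ * μ ≤ 1 / Real.sqrt s₁ * ∑ i ∈ S₁, X i j := by
    intro j hj
    have h1 : S₁.card • μ ≤ ∑ i ∈ S₁, X i j :=
      Finset.card_nsmul_le_sum _ _ _ fun i hi => hin i j hi hj
    rw [hS₁, nsmul_eq_mul] at h1
    calc Real.sqrt s₁ * μ = 1 / Real.sqrt s₁ * (s₁ * μ) := by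
          rw [← mul_assoc, one_div_mul_eq_div, Real.div_sqrt]
      _ ≤ _ := by gcongr
  have hmean0 : ∀ j ∉ S₂, 1 / Real.sqrt s₁ * ∑ i ∈ S₁, X i j = 0 := by
    intro j hj
    rw [Finset.sum_eq_zero fun i _ => hout i j fun h => hj h.2, mul_zero]
  exact measureReal_pi_sum_truncatedSq_le_le hτ hs₂ (by positivity) hmean hmean0 hd
    (by rwa [mul_pow, Real.sq_sqrt (Nat.cast_nonneg _)])

/-- Risk of the test that rejects when the maximal truncated chi-square statistic exceeds `T`. -/
lemma risk_colSumStat_le {d₁ d₂ s₁ s₂ : ℕ} {τ μ L B R T : ℝ} (hτ : 0 < τ) (hL : 0 < L)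
    (hs₁ : 1 ≤ s₁) (hs₂ : 1 ≤ s₂) (hμ : 0 ≤ μ) (hB : 0 ≤ B)
    (hd : d₂ * Real.exp (-τ ^ 2 / 2) ≤ (s₂ : ℝ) ^ 2 / L)
    (hTL : 8 * B * L ≤ T) (hTs : 8 * B * s₂ ≤ T)
    (hsignal : T + R * s₂ ≤ s₂ * (s₁ * μ ^ 2 / 2 - nuTau τ)) :
    risk d₁ d₂ s₁ s₂ μ (fun Y => decide (T < ⨆ J ∈ (Finset.univ : Finset (Fin d₁)).powersetCard s₁,
      colSumStat s₁ τ J Y)) ≤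
        d₁.choose s₁ * Real.exp (12 * L - B * L) + Real.exp (3 + 12 / L - R / 8) := by
  have hs₂0 : (0 : ℝ) < s₂ := by exact_mod_cast hs₂
  have hT : 0 ≤ T := (by positivity : 0 ≤ 8 * B * L).trans hTL
  refine risk_le (Real.exp_nonneg _) ?_ fun X hX => ?_
  · simp only [decide_eq_true_eq]
    refine measureReal_Pmeas_lt_iSup_colSumStat_le 0 hT fun J hJ => ?_
    rw [measureReal_Pmeas_colSumStat τ hs₁ (Finset.mem_powersetCard.1 hJ).2 0 measurableSet_Ioi]
    simp only [Pi.zero_apply, Finset.sum_const_zero, mul_zero]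
    exact measureReal_pi_lt_sum_truncatedSq_le hτ hL hs₂0 hd hTL hTs
  · simp only [decide_eq_false_iff_not, not_lt]
    exact measureReal_Pmeas_iSup_colSumStat_le_le hX hτ hs₁ hs₂ hμ hd hsignal

/-- Analysis of the Bonferroni-corrected truncated χ² test (Lemma B.4). -/
theorem max_truncated_chi_square_test (α c : ℝ) (hα0 : 0 < α) (hα1 : α < 1)
    (hc : 0 < c) :
    ∃ Cμ Ch : ℝ, 0 < Cμ ∧ 0 < Ch ∧
      ∀ (d₁ d₂ s₁ s₂ : ℕ), 0 < d₁ → 0 < d₂ →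
        1 ≤ s₁ → s₁ ≤ d₁ → 1 ≤ s₂ → s₂ ≤ d₂ →
        c ≤ ((d₂ : ℝ) / (s₂ : ℝ) ^ 2) * Real.log (d₁.choose s₁ : ℝ) →
        ∀ μ : ℝ, 0 < μ →
          Cμ * ((1 / (s₁ : ℝ)) *
              Real.log (1 + ((d₂ : ℝ) / (s₂ : ℝ) ^ 2) *
                Real.log (d₁.choose s₁ : ℝ)) +
            (1 / ((s₁ : ℝ) * (s₂ : ℝ))) * Real.log (d₁.choose s₁ : ℝ)) ≤ μ ^ 2 →
          ∀ τ : ℝ,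
            τ = Real.sqrt (max (1 / Real.log (1 + c)) 2 *
              Real.log (1 + ((d₂ : ℝ) / (s₂ : ℝ) ^ 2) *
                Real.log (d₁.choose s₁ : ℝ))) →
            risk d₁ d₂ s₁ s₂ μ
              (fun Y => decide
                (Ch * ((s₂ : ℝ) *
                    Real.log (1 + ((d₂ : ℝ) / (s₂ : ℝ) ^ 2) *
                      Real.log (d₁.choose s₁ : ℝ)) +
                  Real.log (d₁.choose s₁ : ℝ)) <
                  ⨆ J₁ ∈ (Finset.univ : Finset (Fin d₁)).powersetCard s₁,
                    ∑ j, (((1 / Real.sqrt (s₁ : ℝ)) * ∑ i ∈ J₁, Y i j) ^ 2 -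
                        nuTau τ) *
                      (if τ < |(1 / Real.sqrt (s₁ : ℝ)) * ∑ i ∈ J₁, Y i j|
                        then (1 : ℝ) else 0))) ≤ α := by
  set κ := Real.log (1 + c) with hκ
  have hκ0 : 0 < κ := Real.log_pos (by linarith)
  set C₀ := max (1 / κ) 2 with hC₀
  have hC₀2 : 2 ≤ C₀ := le_max_right _ _
  have hC₀κ : 1 / κ ≤ C₀ := le_max_left _ _
  have hlogα : 0 < Real.log (2 / α) := Real.log_pos (by rw [lt_div_iff₀ hα0]; linarith)
  set B := 13 + 2 * Real.log (2 / α) with hB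
  set R := 8 * (27 + Real.log (2 / α)) with hR
  set Ch := 8 * B * (1 + 1 / κ) with hCh
  have hB0 : 0 < B := by positivity
  have hR0 : 0 < R := by positivity
  have hCh0 : 0 < Ch := by positivity
  refine ⟨2 * (Ch + (R + 2) / κ + C₀), Ch, by positivity, hCh0, ?_⟩
  intro d₁ d₂ s₁ s₂ hd₁ hd₂ hs₁ hs₁d hs₂ hs₂d hr μ hμ hμ2 τ hτdef
  set L := Real.log (d₁.choose s₁ : ℝ) with hLdef
  set r := (d₂ : ℝ) / (s₂ : ℝ) ^ 2 * L with hrdef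
  set ℓ := Real.log (1 + r) with hℓdef
  have hs₁1 : (1 : ℝ) ≤ s₁ := by exact_mod_cast hs₁
  have hs₂1 : (1 : ℝ) ≤ s₂ := by exact_mod_cast hs₂
  have hs₁0 : (0 : ℝ) < s₁ := by linarith
  have hs₂0 : (0 : ℝ) < s₂ := by linarith
  have hd₂0 : (0 : ℝ) < d₂ := by exact_mod_cast hd₂
  have hr0 : 0 < r := hc.trans_le hr
  have hL0 : 0 < L := pos_of_mul_pos_right hr0 (by positivity)
  have hchoose : 1 < (d₁.choose s₁ : ℝ) :=
    (Real.log_pos_iff (by positivity)).1 hL0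
  have hL2 : 1 / 2 ≤ L := by
    have : (2 : ℝ) ≤ d₁.choose s₁ := by exact_mod_cast hchoose
    have := Real.log_le_log two_pos this
    linarith [Real.log_two_gt_d9]
  have hκℓ : κ ≤ ℓ := Real.log_le_log (by linarith) (by linarith)
  have hℓ0 : 0 < ℓ := hκ0.trans_le hκℓ
  have hτ2 : τ ^ 2 = C₀ * ℓ := by rw [hτdef, Real.sq_sqrt (by positivity)]
  have hτ0 : 0 < τ := by rw [hτdef]; exact Real.sqrt_pos.2 (by positivity)
  have hd : d₂ * Real.exp (-τ ^ 2 / 2) ≤ (s₂ : ℝ) ^ 2 / L := by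
    have h1 : Real.exp (-τ ^ 2 / 2) ≤ r⁻¹ :=
      calc _ ≤ Real.exp (-ℓ) := Real.exp_le_exp.2 (by rw [neg_div, hτ2]; nlinarith)
        _ = (1 + r)⁻¹ := by rw [Real.exp_neg, Real.exp_log (by linarith)]
        _ ≤ r⁻¹ := inv_anti₀ hr0 (by linarith)
    calc _ ≤ d₂ * r⁻¹ := by gcongr
      _ = _ := by rw [hrdef]; field_simp
  set T := Ch * ((s₂ : ℝ) * ℓ + L) with hTdef
  have hsκ : (s₂ : ℝ) ≤ s₂ * ℓ / κ := by rw [le_div_iff₀ hκ0]; gcongr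
  have hTL : 8 * B * L ≤ T := by
    have h1 : 8 * B ≤ Ch := le_mul_of_one_le_right (by positivity) (by simp [hκ0.le])
    have h2 : 0 ≤ Ch * (s₂ * ℓ) := by positivity
    rw [hTdef]; nlinarith
  have hTs : 8 * B * s₂ ≤ T := by
    have h1 : 8 * B * (s₂ * ℓ / κ) ≤ Ch * (s₂ * ℓ) := by
      have : 0 ≤ 8 * B * (s₂ * ℓ) := by positivity
      have e : Ch * (s₂ * ℓ) = 8 * B * (s₂ * ℓ) + 8 * B * (s₂ * ℓ / κ) := by rw [hCh]; ring
      linarith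
    have h2 := mul_le_mul_of_nonneg_left hsκ (by positivity : 0 ≤ 8 * B)
    have h3 : 0 ≤ Ch * L := by positivity
    rw [hTdef]; linarith
  have hexpα : Real.exp (-Real.log (2 / α)) = α / 2 := by
    rw [Real.exp_neg, Real.exp_log (by positivity), inv_div]
  have hsignal : T + R * s₂ ≤ s₂ * (s₁ * μ ^ 2 / 2 - nuTau τ) := by
    have h1 := mul_le_mul_of_nonneg_left hμ2 (by positivity : 0 ≤ (s₁ : ℝ) * s₂)
    have h2 : (s₁ : ℝ) * s₂ * (2 * (Ch + (R + 2) / κ + C₀) *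
        (1 / (s₁ : ℝ) * ℓ + 1 / ((s₁ : ℝ) * s₂) * L)) =
        2 * (Ch + (R + 2) / κ + C₀) * (s₂ * ℓ + L) := by
      field_simp
    have h3 : s₂ * nuTau τ ≤ s₂ * (C₀ * ℓ + 2) := by
      have := nuTau_le hτ0
      rw [hτ2] at this
      gcongr
    have h4 := mul_le_mul_of_nonneg_left hsκ (by positivity : 0 ≤ R + 2)
    have h5 : 0 ≤ ((R + 2) / κ + C₀) * L := by positivity
    have h6 : (R + 2) * (s₂ * ℓ / κ) = (R + 2) / κ * (s₂ * ℓ) := by ring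
    rw [h2] at h1
    rw [hTdef]
    linarith
  refine (risk_colSumStat_le hτ0 hL0 hs₁ hs₂ hμ.le hB0.le hd hTL hTs hsignal).trans ?_
  have h₀ : d₁.choose s₁ * Real.exp (12 * L - B * L) ≤ α / 2 := by
    rw [← Real.exp_log (by linarith : (0 : ℝ) < d₁.choose s₁), ← hLdef, ← Real.exp_add, ← hexpα,
      Real.exp_le_exp, hB]
    linarith [mul_le_mul_of_nonneg_left hL2 hlogα.le]
  have h₁ : Real.exp (3 + 12 / L - R / 8) ≤ α / 2 := by
    have h12 : 12 / L ≤ 24 := by rw [div_le_iff₀ hL0]; linarith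
    rw [← hexpα, Real.exp_le_exp, hR]
    linarith
  linarith
end

section
/- (Geometric series bound on the second moment.) Let α > 0. There exist constants C* ≥ 1 and c_μ > 0 depending only on α such that for all positive integers d₁, d₂ and integers 1 ≤ s₁ ≤ d₁/2, 1 ≤ s₂ ≤ d₂, every subset A ⊆ { ⌈C*·s₁²/d₁⌉, …, s₁ } of integers, and every μ > 0 with μ² ≤ min_{k∈A} (1/k)·log( 1 + (d₂/s₂)·( exp( (c_μ·k/s₂)·log( k·d₁/(2e·s₁²) ) ) − 1 ) ), it holds that E[ exp(μ²·X·Y)·1(X ∈ A) ] < α. -/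
/-- The binomial point mass: P(X = k) for X ~ Binomial(n, p). -/
noncomputable def binomP (n : ℕ) (p : ℝ) (k : ℕ) : ℝ :=
  (n.choose k : ℝ) * p ^ k * (1 - p) ^ (n - k)

/-- Expectation E[f(X,Y)] for independent X ~ Binomial(s₁, s₁/d₁) and
Y ~ Binomial(s₂, s₂/d₂). -/
noncomputable def Eexp (s₁ s₂ d₁ d₂ : ℕ) (f : ℕ → ℕ → ℝ) : ℝ :=
  ∑ k ∈ Finset.range (s₁ + 1), ∑ l ∈ Finset.range (s₂ + 1),
    binomP s₁ ((s₁ : ℝ) / (d₁ : ℝ)) k * binomP s₂ ((s₂ : ℝ) / (d₂ : ℝ)) l * f k l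

lemma binomP_nonneg (n k : ℕ) {p : ℝ} (hp : 0 ≤ p) (hp1 : p ≤ 1) : 0 ≤ binomP n p k := by
  have : 0 ≤ 1 - p := by linarith
  unfold binomP
  positivity

lemma binomP_le_pow_div_factorial (n k : ℕ) {p : ℝ} (hp : 0 ≤ p) (hp1 : p ≤ 1) :
    binomP n p k ≤ ((n : ℝ) * p) ^ k / (k.factorial : ℝ) := by
  have h0 : 0 ≤ 1 - p := by linarith
  have h1 : (1 - p) ^ (n - k) ≤ 1 := pow_le_one₀ h0 (by linarith)
  have h2 : (n.choose k : ℝ) ≤ (n : ℝ) ^ k / (k.factorial : ℝ) := Nat.choose_le_pow_div k n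
  calc binomP n p k ≤ (n.choose k : ℝ) * p ^ k :=
        mul_le_of_le_one_right (by positivity) h1
    _ ≤ (n : ℝ) ^ k / (k.factorial : ℝ) * p ^ k := by gcongr
    _ = ((n : ℝ) * p) ^ k / (k.factorial : ℝ) := by rw [mul_pow]; ring

/-- The moment generating function of the binomial distribution. -/
lemma sum_binomP_mul_exp (n : ℕ) (p t : ℝ) :
    ∑ l ∈ Finset.range (n + 1), binomP n p l * Real.exp (t * l) =
      (1 + p * (Real.exp t - 1)) ^ n := by
  rw [show 1 + p * (Real.exp t - 1) = p * Real.exp t + (1 - p) by ring, add_pow]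
  refine Finset.sum_congr rfl fun l _ => ?_
  rw [binomP, mul_comm t, Real.exp_nat_mul, mul_pow]
  ring

lemma sum_binomP_mul_exp_le (n : ℕ) {p t x : ℝ} (hp : 0 < p) (hp1 : p ≤ 1) (hx : 0 ≤ x)
    (ht : t ≤ Real.log (1 + p⁻¹ * (Real.exp x - 1))) :
    ∑ l ∈ Finset.range (n + 1), binomP n p l * Real.exp (t * l) ≤ Real.exp (n * x) := by
  rw [sum_binomP_mul_exp, Real.exp_nat_mul]
  have hx1 : 0 ≤ Real.exp x - 1 := by linarith [Real.one_le_exp hx]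
  have hpos : 0 < 1 + p⁻¹ * (Real.exp x - 1) := by positivity
  have het : Real.exp t ≤ 1 + p⁻¹ * (Real.exp x - 1) :=
    (Real.le_log_iff_exp_le hpos).1 ht
  apply pow_le_pow_left₀
  · nlinarith [Real.exp_pos t]
  · have h := mul_le_mul_of_nonneg_left het hp.le
    have h' : p * (1 + p⁻¹ * (Real.exp x - 1)) = p + (Real.exp x - 1) := by
      field_simp
    linarith

/-- A Poisson-type weight beats the square root of its own reciprocal geometrically. -/
lemma pow_div_factorial_mul_exp_le {k : ℕ} {q ρ : ℝ} (hk : 0 < k) (hq : 0 < q) (hρ : 0 < ρ)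
    (h : Real.exp 1 / ρ ^ 2 * q ≤ k) :
    q ^ k / (k.factorial : ℝ) *
      Real.exp (1 / 2 * k * Real.log (k / (2 * Real.exp 1 * q))) ≤ ρ ^ k := by
  have hk' : (0 : ℝ) < k := by exact_mod_cast hk
  have he := Real.exp_pos 1
  set r : ℝ := k / (Real.exp 1 * q) with hr
  have hr0 : 0 < r := by positivity
  have hρr : (ρ ^ 2)⁻¹ ≤ r := by
    rw [hr, le_div_iff₀ (by positivity)]
    calc _ = Real.exp 1 / ρ ^ 2 * q := by ring
      _ ≤ k := h
  have hlog : -(2 * Real.log ρ) ≤ Real.log r := by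
    have := Real.log_le_log (by positivity) hρr
    rwa [Real.log_inv, Real.log_pow, Nat.cast_ofNat] at this
  have hlog2 : Real.log (k / (2 * Real.exp 1 * q)) ≤ Real.log r := by
    apply Real.log_le_log (by positivity)
    rw [hr]
    gcongr
    nlinarith
  have h1 : q ^ k / (k.factorial : ℝ) ≤ Real.exp (-(k * Real.log r)) := by
    have h2 : (k : ℝ) ^ k / (k.factorial : ℝ) ≤ Real.exp k :=
      Real.pow_div_factorial_le_exp _ hk'.le k
    rw [Real.exp_neg, Real.exp_nat_mul, Real.exp_log hr0]
    calc q ^ k / (k.factorial : ℝ) = (q / k) ^ k * ((k : ℝ) ^ k / (k.factorial : ℝ)) := by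
          rw [div_pow]; field_simp
      _ ≤ (q / k) ^ k * Real.exp k := by gcongr
      _ = (r ^ k)⁻¹ := by
          rw [← Real.exp_one_pow, ← mul_pow, ← inv_pow, hr, inv_div]
          ring
  calc _ ≤ Real.exp (-(k * Real.log r)) * Real.exp (1 / 2 * k * Real.log r) := by gcongr
    _ = Real.exp (k * (-(1 / 2) * Real.log r)) := by rw [← Real.exp_add]; ring_nf
    _ ≤ Real.exp (k * Real.log ρ) := by gcongr; linarith
    _ = ρ ^ k := by rw [Real.exp_nat_mul, Real.exp_log hρ]

lemma sum_pow_le_two_mul {A : Finset ℕ} {ρ : ℝ} (hρ : 0 ≤ ρ) (hρ2 : ρ ≤ 1 / 2)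
    (hA : ∀ k ∈ A, 0 < k) : ∑ k ∈ A, ρ ^ k ≤ 2 * ρ := by
  have hs : Summable fun k : ℕ => ρ ^ k := summable_geometric_of_lt_one hρ (by linarith)
  have h0 : (0 : ℕ) ∉ A := fun h => (hA 0 h).false
  have h1 : ∑ k ∈ insert 0 A, ρ ^ k ≤ (1 - ρ)⁻¹ := by
    rw [← tsum_geometric_of_lt_one hρ (by linarith)]
    exact hs.sum_le_tsum _ fun _ _ => by positivity
  rw [Finset.sum_insert h0, pow_zero] at h1
  have h2 : (1 - ρ)⁻¹ ≤ 1 + 2 * ρ := by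
    rw [inv_le_iff_one_le_mul₀ (by linarith)]
    nlinarith
  linarith

/-- Geometric series bound on the second moment (Lemma A.2). -/
theorem geom_series_bound (α : ℝ) (hα : 0 < α) :
    ∃ Cs cμ : ℝ, 1 ≤ Cs ∧ 0 < cμ ∧
      ∀ (d₁ d₂ s₁ s₂ : ℕ), 0 < d₁ → 0 < d₂ →
        1 ≤ s₁ → 2 * s₁ ≤ d₁ → 1 ≤ s₂ → s₂ ≤ d₂ →
        ∀ A : Finset ℕ,
          (∀ k ∈ A, Cs * (s₁ : ℝ) ^ 2 / (d₁ : ℝ) ≤ (k : ℝ) ∧ k ≤ s₁) →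
          ∀ μ : ℝ, 0 < μ →
            (∀ k ∈ A, μ ^ 2 ≤ (1 / (k : ℝ)) *
              Real.log (1 + ((d₂ : ℝ) / (s₂ : ℝ)) *
                (Real.exp ((cμ * (k : ℝ) / (s₂ : ℝ)) *
                  Real.log ((k : ℝ) * (d₁ : ℝ) /
                    (2 * Real.exp 1 * (s₁ : ℝ) ^ 2))) - 1))) →
            Eexp s₁ s₂ d₁ d₂ (fun k l =>
              Real.exp (μ ^ 2 * (k : ℝ) * (l : ℝ)) *
                (if k ∈ A then (1 : ℝ) else 0)) < α := by
  obtain ⟨ρ, hρ, hρ2, hρα⟩ : ∃ ρ : ℝ, 0 < ρ ∧ ρ ≤ 1 / 2 ∧ 2 * ρ < α :=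
    ⟨min (1 / 2) (α / 4), by positivity, min_le_left _ _, by
      linarith [min_le_right (1 / 2) (α / 4)]⟩
  have he : 1 ≤ Real.exp 1 := Real.one_le_exp zero_le_one
  have hCs : 4 * Real.exp 1 ≤ Real.exp 1 / ρ ^ 2 := by
    have hsq : 4 * ρ ^ 2 ≤ 1 := by nlinarith
    rw [le_div_iff₀ (by positivity)]
    nlinarith
  refine ⟨Real.exp 1 / ρ ^ 2, 1 / 2, by linarith, by norm_num, ?_⟩
  intro d₁ d₂ s₁ s₂ hd₁ hd₂ hs₁ hsd₁ hs₂ hsd₂ A hA μ hμ hμA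
  have hd₁' : (0 : ℝ) < d₁ := by exact_mod_cast hd₁
  have hd₂' : (0 : ℝ) < d₂ := by exact_mod_cast hd₂
  have hs₁' : (0 : ℝ) < s₁ := by exact_mod_cast hs₁
  have hs₂' : (0 : ℝ) < s₂ := by exact_mod_cast hs₂
  have hp₁ : (s₁ : ℝ) / d₁ ≤ 1 := by
    rw [div_le_one hd₁']
    exact_mod_cast (by omega : s₁ ≤ d₁)
  have hp₂ : (s₂ : ℝ) / d₂ ≤ 1 := by
    rw [div_le_one hd₂']
    exact_mod_cast hsd₂
  set q : ℝ := (s₁ : ℝ) ^ 2 / d₁ with hq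
  have hq0 : 0 < q := by positivity
  have hAq : ∀ k ∈ A, Real.exp 1 / ρ ^ 2 * q ≤ k := fun k hk => by
    rw [hq, ← mul_div_assoc]
    exact (hA k hk).1
  have hApos : ∀ k ∈ A, 0 < k := fun k hk => by
    have : (0 : ℝ) < k := lt_of_lt_of_le (by positivity) (hAq k hk)
    exact_mod_cast this
  have hterm : ∀ k ∈ A, binomP s₁ ((s₁ : ℝ) / d₁) k *
      ∑ l ∈ Finset.range (s₂ + 1), binomP s₂ ((s₂ : ℝ) / d₂) l *
        Real.exp (μ ^ 2 * k * l) ≤ ρ ^ k := by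
    intro k hk
    have hk0 : (0 : ℝ) < k := by exact_mod_cast hApos k hk
    have harg : (k : ℝ) * d₁ / (2 * Real.exp 1 * (s₁ : ℝ) ^ 2) = k / (2 * Real.exp 1 * q) := by
      rw [hq]
      field_simp
    have hμk := hμA k hk
    rw [harg, one_div_mul_eq_div, le_div_iff₀ hk0, ← inv_div (s₂ : ℝ)] at hμk
    have hlog : 0 ≤ Real.log (k / (2 * Real.exp 1 * q)) := by
      apply Real.log_nonneg
      rw [le_div_iff₀ (by positivity)]
      nlinarith [hAq k hk]
    have hmgf := sum_binomP_mul_exp_le s₂ (by positivity) hp₂ (by positivity) hμk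
    have hexp : (s₂ : ℝ) * (1 / 2 * k / s₂ * Real.log (k / (2 * Real.exp 1 * q))) =
        1 / 2 * k * Real.log (k / (2 * Real.exp 1 * q)) := by
      field_simp
    rw [hexp] at hmgf
    have hbin := binomP_le_pow_div_factorial s₁ k (by positivity) hp₁
    rw [show (s₁ : ℝ) * (s₁ / d₁) = q by rw [hq]; ring] at hbin
    calc _ ≤ q ^ k / (k.factorial : ℝ) *
          Real.exp (1 / 2 * k * Real.log (k / (2 * Real.exp 1 * q))) :=
          mul_le_mul hbin hmgf
            (Finset.sum_nonneg fun l _ =>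
              mul_nonneg (binomP_nonneg _ _ (by positivity) hp₂) (Real.exp_pos _).le)
            (by positivity)
      _ ≤ ρ ^ k := pow_div_factorial_mul_exp_le (hApos k hk) hq0 hρ (hAq k hk)
  have hsub : A ⊆ Finset.range (s₁ + 1) := fun k hk =>
    Finset.mem_range.2 (Nat.lt_succ_of_le (hA k hk).2)
  calc Eexp s₁ s₂ d₁ d₂ _ = ∑ k ∈ A, binomP s₁ ((s₁ : ℝ) / d₁) k *
        ∑ l ∈ Finset.range (s₂ + 1), binomP s₂ ((s₂ : ℝ) / d₂) l *
          Real.exp (μ ^ 2 * k * l) := by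
        rw [Eexp]
        symm
        refine Finset.sum_subset_zero_on_sdiff hsub (fun k hk => ?_) fun k hk => ?_
        · simp [(Finset.mem_sdiff.1 hk).2]
        · simp only [hk, if_true, mul_one, Finset.mul_sum, mul_assoc]
    _ ≤ ∑ k ∈ A, ρ ^ k := Finset.sum_le_sum hterm
    _ ≤ 2 * ρ := sum_pow_le_two_mul hρ.le hρ2 hApos
    _ < α := hρα
end
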